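/- Let M = (W,R₁,R₂,V) be a model and set R := R₁\R₂. For every formula φ of the fragment L_⟨-⟩₂ (built from atoms, ¬, ∧ and ⟨-⟩₂ only) and every world w ∈ W: M,⟨w⟩ ⊨ φ if and only if the sabotage model (W,R,V) satisfies φ' at w, where φ' is the sabotage modal formula obtained from φ by replacing every occurrence of ⟨-⟩₂ with the sabotage modality ⟨-⟩. -/

import Mathlib

attribute [local instance] Classical.propDecidable

/-- Formulas of the modal logic of supervised learning (SLL), with atoms indexed by ℕ. -/
inductive Form : Type
  | atom : ℕ → Form
  | neg : Form → Form
  | and : Form → Form → Form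
  | dia : Form → Form   -- ♦
  | rem1 : Form → Form  -- ⟨-⟩₁
  | rem2 : Form → Form  -- ⟨-⟩₂
  | add : Form → Form   -- ⟨+⟩

namespace Form

def or (φ ψ : Form) : Form := .neg ((Form.neg φ).and (Form.neg ψ))
def imp (φ ψ : Form) : Form := Form.or (.neg φ) ψ
def bot : Form := (Form.atom 0).and (.neg (.atom 0))
def top : Form := .neg bot
def box (φ : Form) : Form := .neg (.dia (.neg φ))      -- ■
def boxr1 (φ : Form) : Form := .neg (.rem1 (.neg φ))   -- [-]₁
def boxr2 (φ : Form) : Form := .neg (.rem2 (.neg φ))   -- [-]₂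
def boxadd (φ : Form) : Form := .neg (.add (.neg φ))   -- [+]

end Form

/-- A model of SLL. -/
structure SLLModel (W : Type) where
  R1 : Set (W × W)
  R2 : Set (W × W)
  V : ℕ → Set W

namespace SLLModel
variable {W : Type}

/-- M ⊖ e : delete edge `e` from R₁. -/
def del (M : SLLModel W) (e : W × W) : SLLModel W := { M with R1 := M.R1 \ {e} }

/-- M ⊕ e : add edge `e` to R₁. -/
def addE (M : SLLModel W) (e : W × W) : SLLModel W := { M with R1 := insert e M.R1 }

end SLLModel

/-- `edges w h` is Set(S) for the sequence `S` whose *reverse* is `w :: h`;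
i.e. `w = e(S)` is the last element and `h` lists the earlier elements in reverse order. -/
def edges {W : Type} : W → List W → Set (W × W)
  | _, [] => ∅
  | w, y :: t => insert (y, w) (edges y t)

/-- `trunc e w h` is (the reversed representation of) the truncation `S|_e`:
the initial segment of `S` ending at the source of the first occurrence of `e` in `S`. -/
noncomputable def trunc {W : Type} (e : W × W) : W → List W → W × List W
  | w, [] => (w, [])
  | w, y :: t =>
    if e ∈ edges y t then trunc e y t
    else if (y, w) = e then (y, t)
    else (w, y :: t)

/-- Truth of an SLL-formula at a pointed model: the evaluation sequence `S` is
represented in reverse as `w :: h` with `w = e(S)`. -/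
def Sat {W : Type} : SLLModel W → Form → W → List W → Prop
  | M, .atom n, w, _ => w ∈ M.V n
  | M, .neg φ, w, h => ¬ Sat M φ w h
  | M, .and φ ψ, w, h => Sat M φ w h ∧ Sat M ψ w h
  | M, .dia φ, w, h => ∃ v, (w, v) ∈ M.R1 ∧ Sat M φ v (w :: h)
  | M, .rem1 φ, w, h => ∃ e, e ∈ edges w h ∧ e ∉ M.R2 ∧
      Sat (M.del e) φ (trunc e w h).1 (trunc e w h).2
  | M, .rem2 φ, w, h => ∃ e, e ∈ M.R1 ∧ e ∉ M.R2 ∧ e ∉ edges w h ∧ Sat (M.del e) φ w h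
  | M, .add φ, w, h => ∃ e, e ∈ M.R2 ∧ e ∉ M.R1 ∧ Sat (M.addE e) φ w h

/-- The fragment L_⟨-⟩₂ : only atoms, ¬, ∧ and ⟨-⟩₂. -/
def InRem2Frag : Form → Prop
  | .atom _ => True
  | .neg φ => InRem2Frag φ
  | .and φ ψ => InRem2Frag φ ∧ InRem2Frag ψ
  | .rem2 φ => InRem2Frag φ
  | _ => False

/-- Sabotage modal formulas. -/
inductive SForm : Type
  | atom : ℕ → SForm
  | neg : SForm → SForm
  | and : SForm → SForm → SForm
  | sab : SForm → SForm  -- ⟨-⟩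

/-- Sabotage modal logic semantics on (W,R,V). -/
def SSat {W : Type} (V : ℕ → Set W) : SForm → Set (W × W) → W → Prop
  | .atom n, _, w => w ∈ V n
  | .neg φ, R, w => ¬ SSat V φ R w
  | .and φ ψ, R, w => SSat V φ R w ∧ SSat V ψ R w
  | .sab φ, R, w => ∃ e ∈ R, SSat V φ (R \ {e}) w

/-- φ' : replace every ⟨-⟩₂ by the sabotage modality ⟨-⟩ (arbitrary on the other
modalities, which do not occur in the fragment L_⟨-⟩₂). -/
def sabTr : Form → SForm
  | .atom n => .atom n
  | .neg φ => .neg (sabTr φ)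
  | .and φ ψ => .and (sabTr φ) (sabTr ψ)
  | .dia φ => sabTr φ
  | .rem1 φ => sabTr φ
  | .rem2 φ => .sab (sabTr φ)
  | .add φ => sabTr φ

/-- Let M = (W,R₁,R₂,V) and R := R₁ \ R₂. For every φ in L_⟨-⟩₂ and every w ∈ W:
M,⟨w⟩ ⊨ φ iff the sabotage model (W,R,V) satisfies φ' at w. -/
theorem rem2Frag_is_sabotage (W : Type) (M : SLLModel W) (w : W)
    (φ : Form) (hφ : InRem2Frag φ) :
    Sat M φ w [] ↔ SSat M.V (sabTr φ) (M.R1 \ M.R2) w := by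
  induction φ generalizing M with
  | atom n => simp only [Sat, sabTr, SSat]
  | neg φ ih =>
    simp only [Sat, sabTr, SSat]
    exact not_congr (ih M hφ)
  | and φ ψ ih1 ih2 =>
    simp only [Sat, sabTr, SSat]
    exact and_congr (ih1 M hφ.1) (ih2 M hφ.2)
  | dia φ ih => exact hφ.elim
  | rem1 φ ih => exact hφ.elim
  | add φ ih => exact hφ.elim
  | rem2 φ ih =>
    simp only [Sat, sabTr, SSat]
    refine exists_congr fun e => ?_
    have key := ih (M.del e) hφ
    have hR : (M.del e).R1 \ (M.del e).R2 = (M.R1 \ M.R2) \ {e} := by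
      ext x
      simp only [SLLModel.del, Set.mem_diff]
      tauto
    rw [hR] at key
    have hV : (M.del e).V = M.V := rfl
    rw [hV] at key
    rw [key]
    simp only [edges, Set.mem_diff, Set.mem_empty_iff_false, not_false_eq_true, true_and]
    tauto
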